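/- arXiv:1510.02152 — 6 statements merged into one kernel-verified Lean document; each statement's English description precedes it below -/
import Mathlib

section
/- Let θ : ℝ³ → ℝ be twice continuously differentiable and let J : ℝ³ → ℝ³ be a continuously differentiable vector field such that Δθ(x) = div J(x) for every x ∈ ℝ³ (where Δθ denotes the Laplacian of θ, i.e. the divergence of its gradient). Suppose there exist constants μ ∈ ℝ, C > 0 and R₀ > 0 such that for all x with ‖x‖ ≥ R₀ one has ‖J(x)‖ ≤ C‖x‖⁻³ and ‖∇θ(x) + μ·x/‖x‖³‖ ≤ C‖x‖⁻³. Then μ = 0. -/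
open Filter

noncomputable section

/-- The divergence of a vector field on `ℝ³`, as the sum of the diagonal entries of its
Fréchet derivative with respect to the standard orthonormal basis. -/
def div3 (J : EuclideanSpace ℝ (Fin 3) → EuclideanSpace ℝ (Fin 3))
    (x : EuclideanSpace ℝ (Fin 3)) : ℝ :=
  ∑ i : Fin 3, fderiv ℝ J x (EuclideanSpace.single i 1) i

/-- The Laplacian of a scalar field on `ℝ³`, as the divergence of its gradient. -/
def laplacian3 (θ : EuclideanSpace ℝ (Fin 3) → ℝ) (x : EuclideanSpace ℝ (Fin 3)) : ℝ :=
  div3 (gradient θ) x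

open MeasureTheory Topology
open scoped RealInnerProductSpace Gradient ContDiff

/-- The weak form of the divergence theorem: a divergence-free `C¹` vector field integrates to zero
against the differential of a compactly supported `C¹` test function. -/
theorem integral_fderiv_apply_eq_zero_of_div3_eq_zero
    {V : EuclideanSpace ℝ (Fin 3) → EuclideanSpace ℝ (Fin 3)} {φ : EuclideanSpace ℝ (Fin 3) → ℝ}
    (hV : ContDiff ℝ 1 V) (hdiv : ∀ x, div3 V x = 0)
    (hφ : ContDiff ℝ 1 φ) (hφc : HasCompactSupport φ) :
    ∫ x, fderiv ℝ φ x (V x) = 0 := by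
  let e (i : Fin 3) : EuclideanSpace ℝ (Fin 3) := EuclideanSpace.single i 1
  have hVi (i : Fin 3) : ContDiff ℝ 1 fun x => V x i := by fun_prop
  have hfderiv (i : Fin 3) (x v : EuclideanSpace ℝ (Fin 3)) :
      fderiv ℝ (fun y => V y i) x v = fderiv ℝ V x v i := by
    have h := ((EuclideanSpace.proj i : EuclideanSpace ℝ (Fin 3) →L[ℝ] ℝ).hasFDerivAt.comp x
      (hV.differentiable one_ne_zero x).hasFDerivAt).fderiv
    exact congrArg (fun L => L v) h
  have hint₁ (i : Fin 3) : Integrable fun x => fderiv ℝ φ x (e i) * V x i := by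
    refine Continuous.integrable_of_hasCompactSupport ?_ ((hφc.fderiv_apply ℝ (e i)).mul_right)
    exact ((hφ.continuous_fderiv one_ne_zero).clm_apply continuous_const).mul (hVi i).continuous
  have hint₂ (i : Fin 3) : Integrable fun x => φ x * fderiv ℝ (fun y => V y i) x (e i) := by
    refine Continuous.integrable_of_hasCompactSupport ?_ hφc.mul_right
    exact hφ.continuous.mul
      (((hVi i).continuous_fderiv one_ne_zero).clm_apply continuous_const)
  have hint₃ (i : Fin 3) : Integrable fun x => φ x * V x i :=
    (hφ.continuous.mul (hVi i).continuous).integrable_of_hasCompactSupport hφc.mul_right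
  have hparts (i : Fin 3) : ∫ x, fderiv ℝ φ x (e i) * V x i =
      -∫ x, φ x * fderiv ℝ (fun y => V y i) x (e i) := by
    rw [integral_mul_fderiv_eq_neg_fderiv_mul_of_integrable (hint₁ i) (hint₂ i) (hint₃ i)
      (fun x _ => hφ.differentiable one_ne_zero x)
      (fun x _ => (hVi i).differentiable one_ne_zero x), neg_neg]
  have hexpand (x : EuclideanSpace ℝ (Fin 3)) :
      fderiv ℝ φ x (V x) = ∑ i, fderiv ℝ φ x (e i) * V x i := by
    have h : V x = ∑ i, V x i • e i := by
      simpa [e] using ((EuclideanSpace.basisFun (Fin 3) ℝ).sum_repr (V x)).symm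
    conv_lhs => rw [h]
    simp [mul_comm]
  calc ∫ x, fderiv ℝ φ x (V x) = ∑ i, ∫ x, fderiv ℝ φ x (e i) * V x i := by
        simp_rw [hexpand]
        exact integral_finsetSum _ fun i _ => hint₁ i
    _ = -∫ x, φ x * div3 V x := by
        simp_rw [hparts, Finset.sum_neg_distrib, div3, Finset.mul_sum]
        rw [integral_finsetSum _ fun i _ => by simpa only [hfderiv] using hint₂ i]
        simp only [hfderiv, e]
    _ = 0 := by simp [hdiv]

/-- The derivative of `Real.smoothTransition` vanishes on `(1, ∞)`. -/
theorem deriv_smoothTransition_of_one_lt {t : ℝ} (ht : 1 < t) :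
    deriv Real.smoothTransition t = 0 := by
  have h : Real.smoothTransition =ᶠ[𝓝 t] fun _ => 1 := by
    filter_upwards [lt_mem_nhds ht] with s hs using Real.smoothTransition.one_of_one_le hs.le
  rw [h.deriv_eq, deriv_const]

/-- A divergence-free `C¹` vector field cannot point strictly inwards everywhere far away. -/
theorem exists_le_norm_inner_nonneg_of_div3_eq_zero
    {V : EuclideanSpace ℝ (Fin 3) → EuclideanSpace ℝ (Fin 3)}
    (hV : ContDiff ℝ 1 V) (hdiv : ∀ x, div3 V x = 0) {R : ℝ} (hR : 0 < R) :
    ∃ x, R ≤ ‖x‖ ∧ 0 ≤ ⟪x, V x⟫ := by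
  by_contra! hneg
  let s (x : EuclideanSpace ℝ (Fin 3)) : ℝ := 2 - ‖x‖ ^ 2 / R ^ 2
  let φ (x : EuclideanSpace ℝ (Fin 3)) : ℝ := Real.smoothTransition (s x)
  have hφ : ContDiff ℝ 1 φ := by
    have hs : ContDiff ℝ 1 s := contDiff_const.sub ((contDiff_norm_sq ℝ).div_const _)
    exact (Real.smoothTransition.contDiff (n := 1)).comp hs
  have hφc : HasCompactSupport φ := by
    refine HasCompactSupport.intro (isCompact_closedBall 0 (2 * R)) fun x hx => ?_
    refine Real.smoothTransition.zero_of_nonpos ?_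
    have hx' : 2 * R < ‖x‖ := by simpa using hx
    have : 2 ≤ ‖x‖ ^ 2 / R ^ 2 := by
      rw [le_div_iff₀ (by positivity)]
      nlinarith
    simp only [s]
    linarith
  have hfderiv (x v : EuclideanSpace ℝ (Fin 3)) :
      fderiv ℝ φ x v = deriv Real.smoothTransition (s x) * (-(2 * ⟪x, v⟫ / R ^ 2)) := by
    have hs : HasFDerivAt s (-((R ^ 2)⁻¹ • (2 • innerSL ℝ x))) x := by
      have h := ((hasStrictFDerivAt_norm_sq x).hasFDerivAt.mul_const (R ^ 2)⁻¹).const_sub 2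
      simpa only [s, div_eq_mul_inv] using h
    have hψ := ((Real.smoothTransition.contDiff (n := 1)).differentiable one_ne_zero
      (s x)).hasDerivAt
    rw [show φ = Real.smoothTransition ∘ s from rfl, (hψ.comp_hasFDerivAt x hs).fderiv]
    change _ * -((R ^ 2)⁻¹ * (2 • ⟪x, v⟫)) = _
    rw [two_nsmul]
    ring
  have hnonneg (x : EuclideanSpace ℝ (Fin 3)) : 0 ≤ fderiv ℝ φ x (V x) := by
    rw [hfderiv]
    rcases le_or_gt R ‖x‖ with hx | hx
    · refine mul_nonneg Real.smoothTransition.monotone.deriv_nonneg ?_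
      rw [← neg_div]
      exact div_nonneg (by linarith [hneg x hx]) (by positivity)
    · rw [deriv_smoothTransition_of_one_lt, zero_mul]
      have : ‖x‖ ^ 2 / R ^ 2 < 1 := by
        rw [div_lt_one (by positivity)]
        gcongr
      simp only [s]
      linarith
  obtain ⟨t, ⟨ht₀, ht₁⟩, ht⟩ := exists_deriv_eq_slope Real.smoothTransition zero_lt_one
    Real.smoothTransition.continuous.continuousOn
    ((Real.smoothTransition.contDiff (n := 1)).differentiable one_ne_zero).differentiableOn
  let y : EuclideanSpace ℝ (Fin 3) := EuclideanSpace.single 0 (R * √(2 - t))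
  have hy : ‖y‖ = R * √(2 - t) := by
    simp [y, abs_of_pos hR]
  have hsy : s y = t := by
    simp only [s, hy]
    rw [mul_pow, Real.sq_sqrt (by linarith)]
    field_simp
    ring
  have hRy : R ≤ ‖y‖ := by
    rw [hy]
    exact le_mul_of_one_le_right hR.le (Real.one_le_sqrt.2 (by linarith))
  have hpos : fderiv ℝ φ y (V y) ≠ 0 := by
    rw [hfderiv, hsy, ht]
    have := (hneg y hRy).ne
    simp [this, hR.ne']
  have hcont : Continuous fun x => fderiv ℝ φ x (V x) :=
    (hφ.continuous_fderiv one_ne_zero).clm_apply hV.continuous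
  have hsupp : HasCompactSupport fun x => fderiv ℝ φ x (V x) :=
    (hφc.fderiv ℝ).mono' fun x hx => subset_tsupport _ fun h => hx (by simp [h])
  exact (hcont.integral_pos_of_hasCompactSupport_nonneg_nonzero (μ := volume) hsupp hnonneg
    hpos).ne' (integral_fderiv_apply_eq_zero_of_div3_eq_zero hV hdiv hφ hφc)

/-- The coefficient `μ` of an inverse-square radial field `-μ x / ‖x‖³` is nonpositive if this field
agrees up to `O(‖x‖⁻³)` with a divergence-free `C¹` vector field. -/
theorem monopole_coeff_nonpos_of_div3_eq_zero
    {V : EuclideanSpace ℝ (Fin 3) → EuclideanSpace ℝ (Fin 3)}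
    (hV : ContDiff ℝ 1 V) (hdiv : ∀ x, div3 V x = 0) {μ K R₀ : ℝ} (hR₀ : 0 < R₀)
    (hdecay : ∀ x, R₀ ≤ ‖x‖ → ‖V x + (μ / ‖x‖ ^ 3) • x‖ ≤ K * ‖x‖⁻¹ ^ 3) :
    μ ≤ 0 := by
  by_contra! hμ
  obtain ⟨x, hx, hxV⟩ := exists_le_norm_inner_nonneg_of_div3_eq_zero hV hdiv
    (R := max R₀ (K / μ + 1)) (lt_max_of_lt_left hR₀)
  have hx₀ : 0 < ‖x‖ := hR₀.trans_le ((le_max_left _ _).trans hx)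
  have hK : K < μ * ‖x‖ := by
    have h : K / μ < ‖x‖ := (lt_add_one _).trans_le ((le_max_right _ _).trans hx)
    rwa [div_lt_iff₀' hμ] at h
  have h : ⟪x, V x⟫ + μ / ‖x‖ ≤ K / ‖x‖ ^ 2 :=
    calc ⟪x, V x⟫ + μ / ‖x‖ = ⟪x, V x + (μ / ‖x‖ ^ 3) • x⟫ := by
          rw [inner_add_right, real_inner_smul_right, real_inner_self_eq_norm_sq]
          field_simp
      _ ≤ ‖x‖ * ‖V x + (μ / ‖x‖ ^ 3) • x‖ := real_inner_le_norm _ _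
      _ ≤ ‖x‖ * (K * ‖x‖⁻¹ ^ 3) := by
          gcongr
          exact hdecay x ((le_max_left _ _).trans hx)
      _ = K / ‖x‖ ^ 2 := by field_simp
  have h' : K / ‖x‖ ^ 2 < μ / ‖x‖ := by
    rw [div_lt_div_iff₀ (by positivity) hx₀]
    nlinarith
  linarith

/-- The divergence of a difference of differentiable vector fields. -/
theorem div3_sub {V W : EuclideanSpace ℝ (Fin 3) → EuclideanSpace ℝ (Fin 3)}
    (hV : Differentiable ℝ V) (hW : Differentiable ℝ W) (x : EuclideanSpace ℝ (Fin 3)) :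
    div3 (fun y => V y - W y) x = div3 V x - div3 W x := by
  simp [div3, fderiv_fun_sub (hV x) (hW x), Finset.sum_sub_distrib]

/-- The gradient of a `C²` function is `C¹`. -/
theorem contDiff_one_gradient {θ : EuclideanSpace ℝ (Fin 3) → ℝ} (hθ : ContDiff ℝ 2 θ) :
    ContDiff ℝ 1 (gradient θ) :=
  (InnerProductSpace.toDual ℝ (EuclideanSpace ℝ (Fin 3))).symm.contDiff.comp
    (hθ.fderiv_right (m := 1) (by norm_num))

/-- If a `C²` scalar field `θ` on flat `ℝ³` satisfies `Δθ = div J` for a `C¹` vector field `J`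
decaying as `‖x‖⁻³`, and the gradient of `θ` agrees with that of a monopole `μ/‖x‖` up to
`O(‖x‖⁻³)` remainders, then the scalar monopole charge `μ` vanishes. -/
theorem scalar_monopole_charge_vanishes
    (θ : EuclideanSpace ℝ (Fin 3) → ℝ) (J : EuclideanSpace ℝ (Fin 3) → EuclideanSpace ℝ (Fin 3))
    (hθ : ContDiff ℝ 2 θ) (hJ : ContDiff ℝ 1 J)
    (heq : ∀ x, laplacian3 θ x = div3 J x)
    (μ C R₀ : ℝ) (hC : 0 < C) (hR₀ : 0 < R₀)
    (hJdecay : ∀ x : EuclideanSpace ℝ (Fin 3), R₀ ≤ ‖x‖ → ‖J x‖ ≤ C * ‖x‖⁻¹ ^ 3)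
    (hgrad : ∀ x : EuclideanSpace ℝ (Fin 3), R₀ ≤ ‖x‖ →
      ‖gradient θ x + (μ / ‖x‖ ^ 3) • x‖ ≤ C * ‖x‖⁻¹ ^ 3) :
    μ = 0 := by
  have hg := contDiff_one_gradient hθ
  have hgd := hg.differentiable one_ne_zero
  have hJd := hJ.differentiable one_ne_zero
  have hbound (x : EuclideanSpace ℝ (Fin 3)) (hx : R₀ ≤ ‖x‖) :
      ‖gradient θ x - J x + (μ / ‖x‖ ^ 3) • x‖ ≤ 2 * C * ‖x‖⁻¹ ^ 3 :=
    calc ‖gradient θ x - J x + (μ / ‖x‖ ^ 3) • x‖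
        = ‖gradient θ x + (μ / ‖x‖ ^ 3) • x - J x‖ := by congr 1; abel
      _ ≤ ‖gradient θ x + (μ / ‖x‖ ^ 3) • x‖ + ‖J x‖ := norm_sub_le _ _
      _ ≤ 2 * C * ‖x‖⁻¹ ^ 3 := by linarith [hgrad x hx, hJdecay x hx]
  have hle : μ ≤ 0 :=
    monopole_coeff_nonpos_of_div3_eq_zero (V := fun x => gradient θ x - J x) (hg.sub hJ)
      (fun x => by rw [div3_sub hgd hJd, ← heq x, laplacian3, sub_self]) hR₀ hbound
  have hge : -μ ≤ 0 := by
    refine monopole_coeff_nonpos_of_div3_eq_zero (V := fun x => J x - gradient θ x) (hJ.sub hg)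
      (fun x => by rw [div3_sub hJd hgd, ← heq x, laplacian3, sub_self]) (K := 2 * C) hR₀
      fun x hx => ?_
    rw [← norm_neg]
    refine le_trans (le_of_eq ?_) (hbound x hx)
    congr 1
    rw [neg_div, neg_smul]
    abel
  linarith

end
end

section
/- Let M > 0 and α, μ ∈ ℝ, and define θ_ext : (2M, ∞) → ℝ by θ_ext(r) = 2α/(M r) + 2α/r² + 8αM/(3r³) + (α/M² − μ/2)·ln(1 − 2M/r). Then θ_ext is twice differentiable on (2M, ∞) and satisfies, for all r > 2M, the ordinary differential equation θ_ext''(r) + (2(r − M)/(r(r − 2M)))·θ_ext'(r) = −48 α M²/(r⁵(r − 2M)). -/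
open Real

noncomputable section

/-- The exterior scalar-field solution of decoupled dynamical Gauss-Bonnet gravity on a
Schwarzschild background of mass `M`, with Gauss-Bonnet coupling `α` and scalar
monopole charge parameter `μ` (Eq. 0th-Rot-ext-sol-lin of the paper). -/
def θext (M α μ : ℝ) (r : ℝ) : ℝ :=
  2 * α / (M * r) + 2 * α / r ^ 2 + 8 * α * M / (3 * r ^ 3)
    + (α / M ^ 2 - μ / 2) * Real.log (1 - 2 * M / r)

theorem hasDerivAt_θext (M α μ : ℝ) (hM : 0 < M) {r : ℝ} (hr : 2 * M < r) :
    HasDerivAt (θext M α μ)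
      ((16 * α * M ^ 2 / r ^ 3 - μ * M) / (r * (r - 2 * M))) r := by
  have hr0 : r ≠ 0 := by linarith
  have hs : r - 2 * M ≠ 0 := by linarith
  have hM0 : M ≠ 0 := hM.ne'
  have hlog : 1 - 2 * M / r ≠ 0 := by
    rw [one_sub_div hr0]
    exact div_ne_zero hs hr0
  have h := ((((hasDerivAt_const r (2 * α)).fun_div ((hasDerivAt_id' r).const_mul M)
      (mul_ne_zero hM0 hr0)).fun_add
    ((hasDerivAt_const r (2 * α)).fun_div (hasDerivAt_pow 2 r) (pow_ne_zero 2 hr0))).fun_add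
    ((hasDerivAt_const r (8 * α * M)).fun_div ((hasDerivAt_pow 3 r).const_mul 3)
      (mul_ne_zero three_ne_zero (pow_ne_zero 3 hr0)))).fun_add
    (((((hasDerivAt_const r (2 * M)).fun_div (hasDerivAt_id' r) hr0).const_sub 1).log
      hlog).const_mul (α / M ^ 2 - μ / 2))
  refine h.congr_deriv ?_
  rw [one_sub_div hr0]
  simp only [Nat.cast_ofNat, Nat.add_one_sub_one, zero_mul, mul_one, zero_sub,
    pow_one]
  field_simp
  ring

theorem hasDerivAt_deriv_θext (M α μ : ℝ) (hM : 0 < M) {r : ℝ} (hr : 2 * M < r) :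
    HasDerivAt (deriv (θext M α μ))
      (-(48 * α * M ^ 2) / (r ^ 5 * (r - 2 * M))
        - 2 * (r - M) / (r * (r - 2 * M))
          * ((16 * α * M ^ 2 / r ^ 3 - μ * M) / (r * (r - 2 * M)))) r := by
  have hr0 : r ≠ 0 := by linarith
  have hs : r - 2 * M ≠ 0 := by linarith
  have h := (((hasDerivAt_const r (16 * α * M ^ 2)).fun_div (hasDerivAt_pow 3 r)
      (pow_ne_zero 3 hr0)).sub_const (μ * M)).fun_div
    ((hasDerivAt_id' r).fun_mul ((hasDerivAt_id' r).sub_const (2 * M))) (mul_ne_zero hr0 hs)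
  refine (h.congr_deriv ?_).congr_of_eventuallyEq ?_
  · field_simp
    ring
  · filter_upwards [Ioi_mem_nhds hr] with x hx
    exact (hasDerivAt_θext M α μ hM hx).deriv

/-- `θext` is twice differentiable on `(2M, ∞)` and satisfies the exterior scalar-field
equation `θ'' + (2(r − M)/(r(r − 2M))) θ' = −48αM²/(r⁵(r − 2M))` there. -/
theorem θext_satisfies_exterior_eq (M α μ : ℝ) (hM : 0 < M) :
    ∀ r ∈ Set.Ioi (2 * M),
      DifferentiableAt ℝ (θext M α μ) r ∧
      DifferentiableAt ℝ (deriv (θext M α μ)) r ∧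
      deriv (deriv (θext M α μ)) r
          + (2 * (r - M) / (r * (r - 2 * M))) * deriv (θext M α μ) r
        = -(48 * α * M ^ 2) / (r ^ 5 * (r - 2 * M)) := by
  intro r hr
  have h₁ := hasDerivAt_θext M α μ hM hr
  have h₂ := hasDerivAt_deriv_θext M α μ hM hr
  refine ⟨h₁.differentiableAt, h₂.differentiableAt, ?_⟩
  rw [h₂.deriv, h₁.deriv, sub_add_cancel]

end
end

section
/- Let M > 0 and α ∈ ℝ, and define θ : (2M, ∞) → ℝ by θ(r) = 2α/(M r) + 2α/r² + 8αM/(3r³) + (α/M²)·ln(1 − 2M/r) (the exterior Gauss-Bonnet scalar solution with vanishing scalar charge, μ = 0). Then lim_{r→∞} r⁴·θ(r) = −4αM²; in particular, the three leading inverse-power contributions cancel and θ(r) decays as 1/r⁴ at spatial infinity. -/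
open Filter Real

noncomputable section

/-- The exterior scalar-field solution of decoupled dynamical Gauss-Bonnet gravity around a
star of mass `M` with Gauss-Bonnet coupling `α` and vanishing scalar monopole charge
(`μ = 0` in Eq. 0th-Rot-ext-sol-lin of the paper). -/
def θzero (M α : ℝ) (r : ℝ) : ℝ :=
  2 * α / (M * r) + 2 * α / r ^ 2 + 8 * α * M / (3 * r ^ 3)
    + (α / M ^ 2) * Real.log (1 - 2 * M / r)

/-- The deviation of `r⁴ θ(r)` from its limit is controlled by the fifth-order remainder of the
Taylor expansion of the logarithm. -/
theorem abs_pow_four_mul_θzero_add_le {M r : ℝ} (α : ℝ) (hM : 0 < M) (hr : 2 * M < r) :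
    |r ^ 4 * θzero M α r + 4 * α * M ^ 2| ≤ 32 * |α| * M ^ 3 / (r - 2 * M) := by
  have hr0 : 0 < r := by linarith
  have hsub : 0 < r - 2 * M := sub_pos.mpr hr
  have hx0 : 0 < 2 * M / r := by positivity
  have hx1 : 2 * M / r < 1 := (div_lt_one hr0).mpr hr
  have key := abs_log_sub_add_sum_range_le (by rwa [abs_of_pos hx0] : |2 * M / r| < 1) 4
  rw [abs_of_pos hx0] at key
  set S := (∑ i ∈ Finset.range 4, (2 * M / r) ^ (i + 1) / ((i : ℝ) + 1)) + log (1 - 2 * M / r)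
    with hS
  have expand : r ^ 4 * θzero M α r + 4 * α * M ^ 2 = α * (r ^ 4 / M ^ 2) * S := by
    simp only [hS, θzero, Finset.sum_range_succ, Finset.sum_range_zero]
    generalize log (1 - 2 * M / r) = L
    push_cast
    field_simp
    ring
  calc |r ^ 4 * θzero M α r + 4 * α * M ^ 2|
      = |α| * (r ^ 4 / M ^ 2) * |S| := by
        rw [expand, abs_mul, abs_mul, abs_of_pos (by positivity : 0 < r ^ 4 / M ^ 2)]
    _ ≤ |α| * (r ^ 4 / M ^ 2) * ((2 * M / r) ^ (4 + 1) / (1 - 2 * M / r)) := by gcongr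
    _ = 32 * |α| * M ^ 3 / (r - 2 * M) := by
        rw [one_sub_div hr0.ne', div_pow]
        field_simp
        ring

/-- When the scalar charge vanishes, the three leading inverse-power contributions cancel
and the exterior scalar field decays as `1/r⁴`: `r⁴ θ(r) → −4αM²` as `r → ∞`. -/
theorem θzero_quartic_decay (M α : ℝ) (hM : 0 < M) :
    Tendsto (fun r => r ^ 4 * θzero M α r) atTop (nhds (-(4 * α * M ^ 2))) := by
  have hbound : Tendsto (fun r : ℝ => 32 * |α| * M ^ 3 / (r - 2 * M)) atTop (nhds 0) :=
    tendsto_const_nhds.div_atTop (tendsto_atTop_add_const_right _ _ tendsto_id)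
  rw [tendsto_iff_norm_sub_tendsto_zero]
  refine squeeze_zero' (Eventually.of_forall fun r => norm_nonneg _) ?_ hbound
  filter_upwards [eventually_gt_atTop (2 * M)] with r hr
  simpa only [sub_neg_eq_add, norm_eq_abs] using abs_pow_four_mul_θzero_add_le α hM hr

end
end

section
/- Let R > 0, 0 < C < 1/2, α ∈ ℝ and θ_c ∈ ℝ, and define θ_int : (0, R) → ℝ by θ_int(r) = θ_c − (4αC/R²)·ln(R² − 2C r²). Then θ_int is twice differentiable on (0, R) and satisfies, for all 0 < r < R, the ordinary differential equation θ_int''(r) = −((5C r² − 2R²)/((2C r² − R²) r))·θ_int'(r) − 48 α C² (C r² − R²)/((2C r² − R²)² R²). -/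
open Real

noncomputable section

/-- The closed-form interior scalar-field solution, regular at the center, for a strongly
anisotropic constant-density star of radius `R` and compactness `C` in decoupled dynamical
Gauss-Bonnet gravity with coupling `α`. -/
def θint (R C α θc : ℝ) (r : ℝ) : ℝ :=
  θc - (4 * α * C / R ^ 2) * Real.log (R ^ 2 - 2 * C * r ^ 2)

theorem sub_two_mul_sq_pos {R C r : ℝ} (hC : C < 1 / 2) (hr : r ∈ Set.Ioo (0 : ℝ) R) :
    0 < R ^ 2 - 2 * C * r ^ 2 := by
  obtain ⟨h0, h1⟩ := hr
  nlinarith [mul_pos (sub_pos.mpr hC) (pow_pos h0 2)]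

theorem hasDerivAt_sub_two_mul_sq (R C r : ℝ) :
    HasDerivAt (fun x : ℝ => R ^ 2 - 2 * C * x ^ 2) (-(4 * C * r)) r := by
  refine (((hasDerivAt_pow 2 r).const_mul (2 * C)).const_sub (R ^ 2)).congr_deriv ?_
  push_cast
  ring

theorem hasDerivAt_θint {R C r : ℝ} (α θc : ℝ) (h : R ^ 2 - 2 * C * r ^ 2 ≠ 0) :
    HasDerivAt (θint R C α θc)
      (16 * α * C ^ 2 / R ^ 2 * (r / (R ^ 2 - 2 * C * r ^ 2))) r := by
  refine ((((hasDerivAt_sub_two_mul_sq R C r).log h).const_mul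
    (4 * α * C / R ^ 2)).const_sub θc).congr_deriv ?_
  ring

theorem hasDerivAt_deriv_θint {R C r : ℝ} (α θc : ℝ) (hC : C < 1 / 2)
    (hr : r ∈ Set.Ioo (0 : ℝ) R) :
    HasDerivAt (deriv (θint R C α θc))
      (16 * α * C ^ 2 / R ^ 2 *
        ((R ^ 2 + 2 * C * r ^ 2) / (R ^ 2 - 2 * C * r ^ 2) ^ 2)) r := by
  have hD := (sub_two_mul_sq_pos hC hr).ne'
  have key := ((hasDerivAt_id' r).fun_div (hasDerivAt_sub_two_mul_sq R C r) hD).const_mul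
    (16 * α * C ^ 2 / R ^ 2)
  have heq : deriv (θint R C α θc) =ᶠ[nhds r]
      fun x => 16 * α * C ^ 2 / R ^ 2 * (x / (R ^ 2 - 2 * C * x ^ 2)) := by
    filter_upwards [isOpen_Ioo.mem_nhds hr] with x hx
    exact (hasDerivAt_θint α θc (sub_two_mul_sq_pos hC hx).ne').deriv
  refine (key.congr_of_eventuallyEq heq).congr_deriv ?_
  ring

/-- `θint` is twice differentiable on `(0, R)` and satisfies the interior scalar-field
equation (Eq. anisotropic-evol of the paper) there. -/
theorem θint_satisfies_interior_eq (R C α θc : ℝ) (hR : 0 < R) (hC0 : 0 < C)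
    (hC : C < 1 / 2) :
    ∀ r ∈ Set.Ioo (0 : ℝ) R,
      DifferentiableAt ℝ (θint R C α θc) r ∧
      DifferentiableAt ℝ (deriv (θint R C α θc)) r ∧
      deriv (deriv (θint R C α θc)) r
        = -((5 * C * r ^ 2 - 2 * R ^ 2) / ((2 * C * r ^ 2 - R ^ 2) * r))
              * deriv (θint R C α θc) r
          - 48 * α * C ^ 2 * (C * r ^ 2 - R ^ 2)
              / ((2 * C * r ^ 2 - R ^ 2) ^ 2 * R ^ 2) := by
  intro r hr
  have hD := (sub_two_mul_sq_pos hC hr).ne'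
  have h1 := hasDerivAt_θint α θc hD
  have h2 := hasDerivAt_deriv_θint α θc hC hr
  refine ⟨h1.differentiableAt, h2.differentiableAt, ?_⟩
  have hr0 : r ≠ 0 := hr.1.ne'
  have hneg : 2 * C * r ^ 2 - R ^ 2 = -(R ^ 2 - 2 * C * r ^ 2) := by ring
  rw [h1.deriv, h2.deriv, hneg]
  field_simp
  ring

end
end

section
/- Let R > 0, 0 < C < 1/2 and α ∈ ℝ, and let θ : (0, R) → ℝ be a twice continuously differentiable solution of θ''(r) = −((5C r² − 2R²)/((2C r² − R²) r))·θ'(r) − 48 α C² (C r² − R²)/((2C r² − R²)² R²) on (0, R) which is bounded on some interval (0, ε) with 0 < ε < R. Then there exists a constant θ_c ∈ ℝ such that θ(r) = θ_c − (4αC/R²)·ln(R² − 2C r²) for all 0 < r < R. -/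
open Real

/-- A function on `(0, R)` whose derivative dominates `c / r ^ 2` with `c > 0` is unbounded
below near `0`. -/
lemma not_bddBelow_near_zero_of_inv_sq_le_deriv {R c : ℝ} (hc : 0 < c) {f f' : ℝ → ℝ}
    (hf : ∀ r ∈ Set.Ioo 0 R, HasDerivAt f (f' r) r)
    (hf' : ∀ r ∈ Set.Ioo 0 R, c / r ^ 2 ≤ f' r) {ε : ℝ} (hε : 0 < ε) (hεR : ε < R) (B : ℝ) :
    ∃ r ∈ Set.Ioo 0 ε, f r < B := by
  by_contra! hB
  have hd : ∀ r ∈ Set.Ioo 0 R, HasDerivAt (fun x => f x + c * x⁻¹) (f' r - c / r ^ 2) r := by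
    intro r hr
    refine HasDerivAt.congr_deriv ((hf r hr).add ((hasDerivAt_inv hr.1.ne').const_mul c)) ?_
    ring
  have hmono : MonotoneOn (fun x => f x + c * x⁻¹) (Set.Ioo 0 R) := by
    refine monotoneOn_of_deriv_nonneg (convex_Ioo 0 R)
      (fun r hr => (hd r hr).continuousAt.continuousWithinAt) ?_ ?_
    · rw [interior_Ioo]
      exact fun r hr => (hd r hr).differentiableAt.differentiableWithinAt
    · rw [interior_Ioo]
      intro r hr
      rw [(hd r hr).deriv]
      exact sub_nonneg.2 (hf' r hr)
  have hlim : Filter.Tendsto (fun x : ℝ => c * x⁻¹) (nhdsWithin 0 (Set.Ioi 0)) Filter.atTop :=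
    tendsto_inv_nhdsGT_zero.const_mul_atTop hc
  obtain ⟨r, hr, hrε⟩ := ((hlim.eventually_gt_atTop (f ε + c * ε⁻¹ - B)).and
    (Ioo_mem_nhdsGT hε)).exists
  have h1 := hmono ⟨hrε.1, hrε.2.trans hεR⟩ ⟨hε, hεR⟩ hrε.2.le
  have h2 := hB r hrε
  simp only at h1
  linarith

/-- A function with vanishing derivative on `(0, R)` is constant there. -/
lemma exists_eq_const_of_hasDerivAt_zero {R : ℝ} {f : ℝ → ℝ}
    (hf : ∀ r ∈ Set.Ioo 0 R, HasDerivAt f 0 r) : ∃ k, ∀ r ∈ Set.Ioo 0 R, f r = k :=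
  isOpen_Ioo.exists_is_const_of_deriv_eq_zero isPreconnected_Ioo
    (fun r hr => (hf r hr).differentiableAt.differentiableWithinAt)
    (fun r hr => (hf r hr).deriv)

/-- A twice continuously differentiable solution of the interior scalar-field equation of a
strongly anisotropic constant-density star which is bounded near the center must belong to
the one-parameter family `θ(r) = θ_c − (4αC/R²) ln(R² − 2Cr²)`. -/
theorem anisotropic_interior_uniqueness (R C α : ℝ) (hR : 0 < R) (hC0 : 0 < C)
    (hC : C < 1 / 2) (θ : ℝ → ℝ)
    (hθ : ContDiffOn ℝ 2 θ (Set.Ioo 0 R))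
    (hode : ∀ r ∈ Set.Ioo (0 : ℝ) R,
      deriv (deriv θ) r
        = -((5 * C * r ^ 2 - 2 * R ^ 2) / ((2 * C * r ^ 2 - R ^ 2) * r)) * deriv θ r
          - 48 * α * C ^ 2 * (C * r ^ 2 - R ^ 2) / ((2 * C * r ^ 2 - R ^ 2) ^ 2 * R ^ 2))
    (hbdd : ∃ ε K : ℝ, 0 < ε ∧ ε < R ∧ ∀ r ∈ Set.Ioo (0 : ℝ) ε, |θ r| ≤ K) :
    ∃ θc : ℝ, ∀ r ∈ Set.Ioo (0 : ℝ) R,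
      θ r = θc - (4 * α * C / R ^ 2) * Real.log (R ^ 2 - 2 * C * r ^ 2) := by
  obtain ⟨ε, K, hε, hεR, hK⟩ := hbdd
  have hR2 : 0 < R ^ 2 := by positivity
  have hDlow : ∀ r ∈ Set.Ioo 0 R, R ^ 2 * (1 - 2 * C) ≤ R ^ 2 - 2 * C * r ^ 2 := by
    intro r hr
    have : r ^ 2 ≤ R ^ 2 := pow_le_pow_left₀ hr.1.le hr.2.le 2
    nlinarith
  have hD0 : 0 < R ^ 2 * (1 - 2 * C) := mul_pos hR2 (by linarith)
  have hD : ∀ r ∈ Set.Ioo 0 R, 0 < R ^ 2 - 2 * C * r ^ 2 :=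
    fun r hr => hD0.trans_le (hDlow r hr)
  have hDup : ∀ r : ℝ, R ^ 2 - 2 * C * r ^ 2 ≤ R ^ 2 := by
    intro r
    have : 0 ≤ 2 * C * r ^ 2 := by positivity
    linarith
  have hDd : ∀ r : ℝ, HasDerivAt (fun x : ℝ => R ^ 2 - 2 * C * x ^ 2) (-(4 * C * r)) r := by
    intro r
    refine HasDerivAt.congr_deriv (((hasDerivAt_pow 2 r).const_mul (2 * C)).const_sub (R ^ 2)) ?_
    norm_num
    ring
  have hθ1 : ∀ r ∈ Set.Ioo 0 R, HasDerivAt θ (deriv θ r) r := fun r hr =>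
    ((hθ.differentiableOn (by norm_num)).differentiableAt (Ioo_mem_nhds hr.1 hr.2)).hasDerivAt
  have hθ2 : ∀ r ∈ Set.Ioo 0 R, HasDerivAt (deriv θ) (deriv (deriv θ) r) r := fun r hr =>
    (((hθ.deriv_of_isOpen (m := 1) isOpen_Ioo (by norm_num)).differentiableOn
      (by norm_num)).differentiableAt (Ioo_mem_nhds hr.1 hr.2)).hasDerivAt
  set φ : ℝ → ℝ := fun r => θ r + (4 * α * C / R ^ 2) * Real.log (R ^ 2 - 2 * C * r ^ 2)
  set u : ℝ → ℝ := fun r =>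
    deriv θ r - 16 * α * C ^ 2 / R ^ 2 * (r / (R ^ 2 - 2 * C * r ^ 2)) with hu
  have hφd : ∀ r ∈ Set.Ioo 0 R, HasDerivAt φ (u r) r := by
    intro r hr
    have hDr := (hD r hr).ne'
    refine HasDerivAt.congr_deriv ((hθ1 r hr).add (((hDd r).log hDr).const_mul
      (4 * α * C / R ^ 2))) ?_
    simp only [hu]
    field_simp
    ring
  have hud : ∀ r ∈ Set.Ioo 0 R, HasDerivAt u
      ((5 * C * r ^ 2 - 2 * R ^ 2) / ((R ^ 2 - 2 * C * r ^ 2) * r) * u r) r := by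
    intro r hr
    have hDr := (hD r hr).ne'
    have hr0 := hr.1.ne'
    refine HasDerivAt.congr_deriv ((hθ2 r hr).sub (((hasDerivAt_id r).div (hDd r) hDr).const_mul
      (16 * α * C ^ 2 / R ^ 2))) ?_
    rw [hode r hr, show 2 * C * r ^ 2 - R ^ 2 = -(R ^ 2 - 2 * C * r ^ 2) by ring]
    simp only [hu, id]
    generalize hE : R ^ 2 - 2 * C * r ^ 2 = E at *
    field_simp
    subst hE
    ring
  obtain ⟨k, hk⟩ : ∃ k, ∀ r ∈ Set.Ioo 0 R,
      r ^ 2 * (R ^ 2 - 2 * C * r ^ 2) ^ (1 / 4 : ℝ) * u r = k := by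
    refine exists_eq_const_of_hasDerivAt_zero fun r hr => ?_
    have hDr := (hD r hr).ne'
    have hr0 := hr.1.ne'
    refine HasDerivAt.congr_deriv (((hasDerivAt_pow 2 r).mul ((hDd r).rpow_const
      (p := 1 / 4) (Or.inl hDr))).mul
      (hud r hr)) ?_
    rw [Real.rpow_sub_one hDr]
    simp only [Pi.mul_apply]
    generalize (R ^ 2 - 2 * C * r ^ 2) ^ (1 / 4 : ℝ) = q
    generalize u r = v
    generalize hE : R ^ 2 - 2 * C * r ^ 2 = E at *
    field_simp
    subst hE
    push_cast
    ring
  have hk0 : k = 0 := by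
    by_contra hk0
    set M : ℝ := (R ^ 2) ^ (1 / 4 : ℝ) with hM
    have hMpos : 0 < M := Real.rpow_pos_of_pos hR2 _
    have hder : ∀ r ∈ Set.Ioo 0 R, k ^ 2 / M / r ^ 2 ≤ k * u r := by
      intro r hr
      have hq : 0 < (R ^ 2 - 2 * C * r ^ 2) ^ (1 / 4 : ℝ) := Real.rpow_pos_of_pos (hD r hr) _
      have hqM : (R ^ 2 - 2 * C * r ^ 2) ^ (1 / 4 : ℝ) ≤ M :=
        Real.rpow_le_rpow (hD r hr).le (hDup r) (by norm_num)
      have hr2 : 0 < r ^ 2 := pow_pos hr.1 2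
      have hkr := hk r hr
      generalize (R ^ 2 - 2 * C * r ^ 2) ^ (1 / 4 : ℝ) = q at *
      have hku : k * u r = k ^ 2 / q / r ^ 2 := by
        rw [eq_div_iff hr2.ne', eq_div_iff hq.ne']
        linear_combination k * hkr
      rw [hku]
      gcongr
    have hbound : ∀ r ∈ Set.Ioo 0 ε, |φ r| ≤ K + |4 * α * C / R ^ 2| *
        max |Real.log (R ^ 2 * (1 - 2 * C))| |Real.log (R ^ 2)| := by
      intro r hr
      have hrR : r ∈ Set.Ioo 0 R := ⟨hr.1, hr.2.trans hεR⟩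
      refine (abs_add_le _ _).trans (add_le_add (hK r hr) ?_)
      rw [abs_mul]
      refine mul_le_mul_of_nonneg_left ?_ (abs_nonneg _)
      exact abs_le_max_abs_abs (Real.log_le_log hD0 (hDlow r hrR))
        (Real.log_le_log (hD r hrR) (hDup r))
    obtain ⟨r, hr, hlt⟩ := not_bddBelow_near_zero_of_inv_sq_le_deriv (by positivity)
      (fun r hr => (hφd r hr).const_mul k) hder hε hεR
      (-(|k| * (K + |4 * α * C / R ^ 2| *
        max |Real.log (R ^ 2 * (1 - 2 * C))| |Real.log (R ^ 2)|)))
    have h1 := mul_le_mul_of_nonneg_left (hbound r hr) (abs_nonneg k)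
    rw [← abs_mul] at h1
    linarith [neg_abs_le (k * φ r)]
  obtain ⟨θc, hθc⟩ : ∃ θc, ∀ r ∈ Set.Ioo 0 R, φ r = θc := by
    refine exists_eq_const_of_hasDerivAt_zero fun r hr => ?_
    have hq : 0 < (R ^ 2 - 2 * C * r ^ 2) ^ (1 / 4 : ℝ) := Real.rpow_pos_of_pos (hD r hr) _
    have hu0 : u r = 0 := (mul_eq_zero.1 ((hk r hr).trans hk0)).resolve_left
      (mul_pos (pow_pos hr.1 2) hq).ne'
    exact hu0 ▸ hφd r hr
  exact ⟨θc, fun r hr => eq_sub_of_add_eq (hθc r hr)⟩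
end

section
/- Let R > 0, 0 < C < 1/2, α ∈ ℝ, and set M = C·R. Let θ : (0, ∞) → ℝ be continuously differentiable on (0, ∞) and twice continuously differentiable on (0, R) and on (R, ∞), bounded on (0, R), satisfying θ''(r) = −((5C r² − 2R²)/((2C r² − R²) r))·θ'(r) − 48 α C² (C r² − R²)/((2C r² − R²)² R²) for 0 < r < R and θ''(r) + (2(r − M)/(r(r − 2M)))·θ'(r) = −48 α M²/(r⁵(r − 2M)) for r > R. Then θ(r) converges to a finite limit θ_∞ as r → ∞, and lim_{r→∞} r·(θ(r) − θ_∞) = 0; that is, the scalar monopole charge of θ vanishes. -/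
open Filter Real

theorem exists_tendsto_of_abs_deriv_le {f f' g g' : ℝ → ℝ} {a : ℝ}
    (hf : ∀ r ∈ Set.Ioi a, HasDerivAt f (f' r) r)
    (hg : ∀ r ∈ Set.Ioi a, HasDerivAt g (g' r) r)
    (hfg : ∀ r ∈ Set.Ioi a, |f' r| ≤ -g' r) (hg0 : Tendsto g atTop (nhds 0)) :
    ∃ L, Tendsto f atTop (nhds L) ∧ ∀ r ∈ Set.Ioi a, |f r - L| ≤ g r := by
  have hanti : AntitoneOn (fun r => f r + g r) (Set.Ioi a) := by
    have hd : ∀ r ∈ Set.Ioi a, HasDerivAt (fun r => f r + g r) (f' r + g' r) r :=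
      fun r hr => (hf r hr).add (hg r hr)
    refine antitoneOn_of_deriv_nonpos (convex_Ioi a)
      (fun r hr => (hd r hr).continuousAt.continuousWithinAt) ?_ ?_ <;> rw [interior_Ioi]
    · exact fun r hr => (hd r hr).differentiableAt.differentiableWithinAt
    · intro r hr
      rw [(hd r hr).deriv]
      linarith [le_abs_self (f' r), hfg r hr]
  have hmono : MonotoneOn (fun r => f r - g r) (Set.Ioi a) := by
    have hd : ∀ r ∈ Set.Ioi a, HasDerivAt (fun r => f r - g r) (f' r - g' r) r :=
      fun r hr => (hf r hr).sub (hg r hr)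
    refine monotoneOn_of_deriv_nonneg (convex_Ioi a)
      (fun r hr => (hd r hr).continuousAt.continuousWithinAt) ?_ ?_ <;> rw [interior_Ioi]
    · exact fun r hr => (hd r hr).differentiableAt.differentiableWithinAt
    · intro r hr
      rw [(hd r hr).deriv]
      linarith [neg_abs_le (f' r), hfg r hr]
  have hdist : ∀ x ∈ Set.Ioi a, ∀ y, x ≤ y → |f y - f x| ≤ g x - g y := by
    intro x hx y hxy
    have hy : y ∈ Set.Ioi a := lt_of_lt_of_le hx hxy
    have h1 := hanti hx hy hxy
    have h2 := hmono hx hy hxy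
    simp only at h1 h2
    exact abs_le.2 ⟨by linarith, by linarith⟩
  have hnonneg : ∀ x ∈ Set.Ioi a, 0 ≤ g x := fun x hx =>
    le_of_tendsto hg0 ((eventually_ge_atTop x).mono fun y hxy => by
      linarith [hdist x hx y hxy, abs_nonneg (f y - f x)])
  have hcauchy : CauchySeq f := by
    rw [Metric.cauchySeq_iff']
    intro ε hε
    obtain ⟨N, hN, haN⟩ := ((hg0.eventually (gt_mem_nhds hε)).and (eventually_gt_atTop a)).exists
    refine ⟨N, fun n hn => ?_⟩
    rw [Real.dist_eq]
    linarith [hdist N haN n hn, hnonneg n (lt_of_lt_of_le haN hn)]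
  obtain ⟨L, hL⟩ := cauchySeq_tendsto_of_complete hcauchy
  refine ⟨L, hL, fun x hx => ?_⟩
  have h := le_of_tendsto_of_tendsto (hL.sub_const (f x)).abs (tendsto_const_nhds (x := g x))
    ((eventually_ge_atTop x).mono fun y hxy => by
      linarith [hdist x hx y hxy, hnonneg y (lt_of_lt_of_le hx hxy)])
  rwa [abs_sub_comm]

/-- A function on `(0, b)` whose derivative, multiplied by a constant `B`, dominates `c / r ^ 2`
with `c > 0` is unbounded near the origin. -/
theorem not_bounded_of_inv_sq_le_mul_deriv {f f' : ℝ → ℝ} {b B c K : ℝ} (hb : 0 < b) (hc : 0 < c)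
    (hf : ∀ r ∈ Set.Ioo 0 b, HasDerivAt f (f' r) r)
    (hle : ∀ r ∈ Set.Ioo 0 b, c / r ^ 2 ≤ B * f' r) : ¬ ∀ r ∈ Set.Ioo 0 b, |f r| ≤ K := by
  intro hK
  have hd : ∀ r ∈ Set.Ioo 0 b, HasDerivAt (fun r => B * f r + c * r⁻¹)
      (B * f' r + c * (-(r ^ 2)⁻¹)) r := fun r hr =>
    ((hf r hr).const_mul B).add ((hasDerivAt_inv hr.1.ne').const_mul c)
  have hmono : MonotoneOn (fun r => B * f r + c * r⁻¹) (Set.Ioo 0 b) := by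
    refine monotoneOn_of_deriv_nonneg (convex_Ioo 0 b)
      (fun r hr => (hd r hr).continuousAt.continuousWithinAt) ?_ ?_ <;> rw [interior_Ioo]
    · exact fun r hr => (hd r hr).differentiableAt.differentiableWithinAt
    · intro r hr
      rw [(hd r hr).deriv]
      have := hle r hr
      rw [div_eq_mul_inv] at this
      linarith
  have hBf : ∀ r ∈ Set.Ioo 0 b, |B * f r| ≤ |B| * K := fun r hr => by
    rw [abs_mul]
    exact mul_le_mul_of_nonneg_left (hK r hr) (abs_nonneg B)
  have hmid : b / 2 ∈ Set.Ioo 0 b := ⟨by linarith, by linarith⟩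
  have htop : Tendsto (fun r : ℝ => c * r⁻¹) (nhdsWithin 0 (Set.Ioi 0)) atTop :=
    tendsto_inv_nhdsGT_zero.const_mul_atTop hc
  obtain ⟨r, hbig, hr0, hr⟩ := ((htop.eventually_gt_atTop
    (2 * (|B| * K) + c * (b / 2)⁻¹)).and (Ioo_mem_nhdsGT hmid.1)).exists
  have hrb : r ∈ Set.Ioo 0 b := ⟨hr0, hr.trans hmid.2⟩
  have h := hmono hrb hmid hr.le
  simp only at h
  linarith [(abs_le.1 (hBf r hrb)).1, (abs_le.1 (hBf _ hmid)).2]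

/-- The only solution of the interior equation which is bounded near the centre is the regular
one. -/
theorem deriv_eq_of_interior_equation {R C α : ℝ} (hR : 0 < R) (hC0 : 0 < C) (hC : C < 1 / 2)
    {θ : ℝ → ℝ} (hθ : DifferentiableOn ℝ θ (Set.Ioo 0 R))
    (hθ' : DifferentiableOn ℝ (deriv θ) (Set.Ioo 0 R))
    (hbdd : ∃ K : ℝ, ∀ r ∈ Set.Ioo (0 : ℝ) R, |θ r| ≤ K)
    (hode : ∀ r ∈ Set.Ioo (0 : ℝ) R,
      deriv (deriv θ) r
        = -((5 * C * r ^ 2 - 2 * R ^ 2) / ((2 * C * r ^ 2 - R ^ 2) * r)) * deriv θ r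
          - 48 * α * C ^ 2 * (C * r ^ 2 - R ^ 2) / ((2 * C * r ^ 2 - R ^ 2) ^ 2 * R ^ 2)) :
    ∀ r ∈ Set.Ioo (0 : ℝ) R,
      deriv θ r = 16 * α * C ^ 2 / R ^ 2 * (r / (R ^ 2 - 2 * C * r ^ 2)) := by
  set k := 16 * α * C ^ 2 / R ^ 2 with hk
  have hulow : ∀ r ∈ Set.Ioo (0 : ℝ) R, R ^ 2 * (1 - 2 * C) ≤ R ^ 2 - 2 * C * r ^ 2 := by
    intro r hr
    have : r ^ 2 ≤ R ^ 2 := pow_le_pow_left₀ hr.1.le hr.2.le 2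
    nlinarith
  have hlow : 0 < R ^ 2 * (1 - 2 * C) := mul_pos (by positivity) (by linarith)
  have hu : ∀ r ∈ Set.Ioo (0 : ℝ) R, 0 < R ^ 2 - 2 * C * r ^ 2 :=
    fun r hr => hlow.trans_le (hulow r hr)
  have huR : ∀ r : ℝ, R ^ 2 - 2 * C * r ^ 2 ≤ R ^ 2 := fun r => by
    have : 0 ≤ 2 * C * r ^ 2 := by positivity
    linarith
  have hdu : ∀ r : ℝ, HasDerivAt (fun r => R ^ 2 - 2 * C * r ^ 2) (-(4 * C * r)) r := fun r => by
    refine (((hasDerivAt_pow 2 r).const_mul (2 * C)).const_sub (R ^ 2)).congr_deriv ?_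
    push_cast
    ring
  have hdθ : ∀ r ∈ Set.Ioo (0 : ℝ) R, HasDerivAt θ (deriv θ r) r := fun r hr =>
    (hθ.differentiableAt (isOpen_Ioo.mem_nhds hr)).hasDerivAt
  have hdθ' : ∀ r ∈ Set.Ioo (0 : ℝ) R, HasDerivAt (deriv θ) (deriv (deriv θ) r) r := fun r hr =>
    (hθ'.differentiableAt (isOpen_Ioo.mem_nhds hr)).hasDerivAt
  have hdG : ∀ r ∈ Set.Ioo (0 : ℝ) R, HasDerivAt (fun r => r ^ 2 *
      (R ^ 2 - 2 * C * r ^ 2) ^ (1 / 4 : ℝ) * (deriv θ r - k * (r / (R ^ 2 - 2 * C * r ^ 2))))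
      0 r := by
    intro r hr
    have hur := hu r hr
    have hr0 := hr.1.ne'
    have h1 := ((hasDerivAt_pow 2 r).mul ((hdu r).rpow_const (p := 1 / 4) (Or.inl hur.ne'))).mul
      ((hdθ' r hr).sub (((hasDerivAt_id r).div (hdu r) hur.ne').const_mul k))
    refine h1.congr_deriv ?_
    simp only [id, Pi.mul_apply, Pi.sub_apply, Pi.div_apply]
    rw [Real.rpow_sub_one hur.ne', hode r hr,
      show 2 * C * r ^ 2 - R ^ 2 = -(R ^ 2 - 2 * C * r ^ 2) by ring,
      show 5 * C * r ^ 2 - 2 * R ^ 2 = C * r ^ 2 - 2 * (R ^ 2 - 2 * C * r ^ 2) by ring,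
      show C * r ^ 2 - R ^ 2 = -(R ^ 2 - 2 * C * r ^ 2) - C * r ^ 2 by ring, hk]
    generalize (R ^ 2 - 2 * C * r ^ 2) ^ (1 / 4 : ℝ) = v
    have hne := hur.ne'
    generalize R ^ 2 - 2 * C * r ^ 2 = u at hne
    push_cast
    field_simp
    ring
  obtain ⟨B, hB⟩ := isOpen_Ioo.exists_is_const_of_deriv_eq_zero isPreconnected_Ioo
    (fun r hr => (hdG r hr).differentiableAt.differentiableWithinAt)
    (fun r hr => (hdG r hr).deriv)
  have hB0 : B = 0 := by
    by_contra hBne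
    obtain ⟨K, hK⟩ := hbdd
    have hdf : ∀ r ∈ Set.Ioo (0 : ℝ) R, HasDerivAt
        (fun r => θ r + k / (4 * C) * log (R ^ 2 - 2 * C * r ^ 2))
        (deriv θ r - k * (r / (R ^ 2 - 2 * C * r ^ 2))) r := fun r hr => by
      refine ((hdθ r hr).add (((hdu r).log (hu r hr).ne').const_mul (k / (4 * C)))).congr_deriv ?_
      have := (hu r hr).ne'
      field_simp
      ring
    refine not_bounded_of_inv_sq_le_mul_deriv (B := B) (c := B ^ 2 / (R ^ 2) ^ (1 / 4 : ℝ))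
      (K := K + |k / (4 * C)| * (|log (R ^ 2 * (1 - 2 * C))| + |log (R ^ 2)|))
      hR (by positivity) hdf ?_ ?_
    · intro r hr
      have hv : 0 < (R ^ 2 - 2 * C * r ^ 2) ^ (1 / 4 : ℝ) := Real.rpow_pos_of_pos (hu r hr) _
      have hvle : (R ^ 2 - 2 * C * r ^ 2) ^ (1 / 4 : ℝ) ≤ (R ^ 2) ^ (1 / 4 : ℝ) :=
        Real.rpow_le_rpow (hu r hr).le (huR r) (by norm_num)
      have hr0 := hr.1
      have hw : deriv θ r - k * (r / (R ^ 2 - 2 * C * r ^ 2))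
          = B / (r ^ 2 * (R ^ 2 - 2 * C * r ^ 2) ^ (1 / 4 : ℝ)) := by
        rw [eq_div_iff (by positivity), ← hB r hr]
        ring
      rw [hw, div_div, mul_div_assoc', ← sq, mul_comm (r ^ 2)]
      gcongr
    · intro r hr
      refine (abs_add_le _ _).trans (add_le_add (hK r hr) ?_)
      rw [abs_mul]
      gcongr
      have h1 := Real.log_le_log hlow (hulow r hr)
      have h2 := Real.log_le_log (hu r hr) (huR r)
      refine abs_le.2 ⟨?_, ?_⟩
      · linarith [neg_abs_le (log (R ^ 2 * (1 - 2 * C))), abs_nonneg (log (R ^ 2))]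
      · linarith [le_abs_self (log (R ^ 2)), abs_nonneg (log (R ^ 2 * (1 - 2 * C)))]
  intro r hr
  have h := hB r hr
  have hv : 0 < (R ^ 2 - 2 * C * r ^ 2) ^ (1 / 4 : ℝ) := Real.rpow_pos_of_pos (hu r hr) _
  have hr0 := hr.1
  rw [hB0] at h
  exact sub_eq_zero.1 ((mul_eq_zero.1 h).resolve_left (by positivity))

/-- First integral of the exterior equation. -/
theorem exists_const_of_exterior_equation {R M α : ℝ} (hR : 0 < R) (hMR : 2 * M < R)
    {θ : ℝ → ℝ} (hθ' : DifferentiableOn ℝ (deriv θ) (Set.Ioi R))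
    (hode : ∀ r ∈ Set.Ioi R,
      deriv (deriv θ) r + (2 * (r - M) / (r * (r - 2 * M))) * deriv θ r
        = -(48 * α * M ^ 2) / (r ^ 5 * (r - 2 * M))) :
    ∃ A, ∀ r ∈ Set.Ioi R, r * (r - 2 * M) * deriv θ r - 16 * α * M ^ 2 * (r ^ 3)⁻¹ = A := by
  have hd : ∀ r ∈ Set.Ioi R, HasDerivAt
      (fun r => r * (r - 2 * M) * deriv θ r - 16 * α * M ^ 2 * (r ^ 3)⁻¹) 0 r := by
    intro r hr
    have hr0 : r ≠ 0 := (hR.trans hr).ne'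
    have hr2 : r - 2 * M ≠ 0 := (sub_pos.2 (hMR.trans hr)).ne'
    have h1 := (hθ'.differentiableAt (isOpen_Ioi.mem_nhds hr)).hasDerivAt
    have h2 := (((hasDerivAt_id r).mul ((hasDerivAt_id r).sub_const (2 * M))).mul h1).sub
      (((hasDerivAt_pow 3 r).inv (pow_ne_zero 3 hr0)).const_mul (16 * α * M ^ 2))
    refine h2.congr_deriv ?_
    simp only [id, Pi.mul_apply]
    rw [eq_sub_of_add_eq (hode r hr)]
    field_simp
    ring
  exact isOpen_Ioi.exists_is_const_of_deriv_eq_zero isPreconnected_Ioi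
    (fun r hr => (hd r hr).differentiableAt.differentiableWithinAt) (fun r hr => (hd r hr).deriv)

/-- A strongly anisotropic constant-density star in decoupled dynamical Gauss-Bonnet gravity
carries no scalar monopole charge: any globally `C¹` scalar field on `(0, ∞)`, twice
continuously differentiable inside and outside the star, bounded in the interior, and
satisfying the interior equation on `(0, R)` and the exterior (Schwarzschild, `M = CR`)
equation on `(R, ∞)`, converges at infinity with `r (θ(r) − θ_∞) → 0`. -/
theorem anisotropic_star_has_no_scalar_charge (R C α : ℝ) (hR : 0 < R) (hC0 : 0 < C)
    (hC : C < 1 / 2) (M : ℝ) (hM : M = C * R) (θ : ℝ → ℝ)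
    (hθ1 : ContDiffOn ℝ 1 θ (Set.Ioi 0))
    (hθint : ContDiffOn ℝ 2 θ (Set.Ioo 0 R))
    (hθext : ContDiffOn ℝ 2 θ (Set.Ioi R))
    (hbdd : ∃ K : ℝ, ∀ r ∈ Set.Ioo (0 : ℝ) R, |θ r| ≤ K)
    (hodeInt : ∀ r ∈ Set.Ioo (0 : ℝ) R,
      deriv (deriv θ) r
        = -((5 * C * r ^ 2 - 2 * R ^ 2) / ((2 * C * r ^ 2 - R ^ 2) * r)) * deriv θ r
          - 48 * α * C ^ 2 * (C * r ^ 2 - R ^ 2) / ((2 * C * r ^ 2 - R ^ 2) ^ 2 * R ^ 2))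
    (hodeExt : ∀ r ∈ Set.Ioi R,
      deriv (deriv θ) r + (2 * (r - M) / (r * (r - 2 * M))) * deriv θ r
        = -(48 * α * M ^ 2) / (r ^ 5 * (r - 2 * M))) :
    ∃ θinf : ℝ, Tendsto θ atTop (nhds θinf) ∧
      Tendsto (fun r => r * (θ r - θinf)) atTop (nhds 0) := by
  have hMR : 2 * M < R := by rw [hM]; nlinarith
  have hdθ : ∀ r ∈ Set.Ioi (0 : ℝ), HasDerivAt θ (deriv θ r) r := fun r hr =>
    ((hθ1.differentiableOn one_ne_zero).differentiableAt (isOpen_Ioi.mem_nhds hr)).hasDerivAt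
  have hcont : ContinuousAt (deriv θ) R :=
    (hθ1.continuousOn_deriv_of_isOpen isOpen_Ioi le_rfl).continuousAt (isOpen_Ioi.mem_nhds hR)
  have hint := deriv_eq_of_interior_equation hR hC0 hC
    (hθint.differentiableOn two_ne_zero)
    ((hθint.deriv_of_isOpen (m := 1) isOpen_Ioo (by norm_num)).differentiableOn one_ne_zero)
    hbdd hodeInt
  obtain ⟨A, hA⟩ := exists_const_of_exterior_equation hR hMR
    ((hθext.deriv_of_isOpen (m := 1) isOpen_Ioi (by norm_num)).differentiableOn one_ne_zero)
    hodeExt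
  have huR : R ^ 2 - 2 * C * R ^ 2 ≠ 0 := by
    have : 0 < R ^ 2 * (1 - 2 * C) := mul_pos (by positivity) (by linarith)
    linarith
  have hsurf : deriv θ R = 16 * α * C ^ 2 / R ^ 2 * (R / (R ^ 2 - 2 * C * R ^ 2)) := by
    refine tendsto_nhds_unique (hcont.tendsto.mono_left (nhdsWithin_le_nhds (s := Set.Iio R))) ?_
    have hc : ContinuousAt (fun r => 16 * α * C ^ 2 / R ^ 2 * (r / (R ^ 2 - 2 * C * r ^ 2))) R :=
      continuousAt_const.mul (continuousAt_id.div (by fun_prop) huR)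
    refine (hc.tendsto.mono_left nhdsWithin_le_nhds).congr' ?_
    filter_upwards [Ioo_mem_nhdsLT hR] with r hr using (hint r hr).symm
  have hA0 : A = 0 := by
    have hc : ContinuousAt
        (fun r => r * (r - 2 * M) * deriv θ r - 16 * α * M ^ 2 * (r ^ 3)⁻¹) R :=
      ((by fun_prop : ContinuousAt (fun r => r * (r - 2 * M)) R).mul hcont).sub
        (continuousAt_const.mul ((continuousAt_id.pow 3).inv₀ (pow_ne_zero 3 hR.ne')))
    have hlim : Tendsto (fun r => r * (r - 2 * M) * deriv θ r - 16 * α * M ^ 2 * (r ^ 3)⁻¹)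
        (nhdsWithin R (Set.Ioi R)) (nhds A) := by
      refine tendsto_const_nhds.congr' ?_
      filter_upwards [self_mem_nhdsWithin] with r hr using (hA r hr).symm
    rw [tendsto_nhds_unique hlim (hc.tendsto.mono_left nhdsWithin_le_nhds), hsurf, hM]
    have h2 : 1 - 2 * C ≠ 0 := by linarith
    rw [show R ^ 2 - 2 * C * R ^ 2 = R ^ 2 * (1 - 2 * C) by ring]
    field_simp
    ring
  set N := 16 * |α| * M ^ 2 / (1 - 2 * C) with hN
  have hg : ∀ r ∈ Set.Ioi R, HasDerivAt (fun r => N / 4 * (r ^ 4)⁻¹) (-(N / r ^ 5)) r := by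
    intro r hr
    have hr0 : r ≠ 0 := (hR.trans hr).ne'
    refine (((hasDerivAt_pow 4 r).inv (pow_ne_zero 4 hr0)).const_mul (N / 4)).congr_deriv ?_
    field_simp
    norm_num
  have hg0 : Tendsto (fun r : ℝ => N / 4 * (r ^ 4)⁻¹) atTop (nhds 0) := by
    simpa using ((tendsto_pow_atTop (α := ℝ) (n := 4) (by norm_num)).inv_tendsto_atTop).const_mul
      (N / 4)
  have hbound : ∀ r ∈ Set.Ioi R, |deriv θ r| ≤ -(-(N / r ^ 5)) := by
    intro r hr
    have hrR : R < r := hr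
    have hr0 : 0 < r := hR.trans hr
    have hr2 : 0 < r - 2 * M := sub_pos.2 (hMR.trans hr)
    have h2 : 0 < 1 - 2 * C := by linarith
    have heq : deriv θ r = 16 * α * M ^ 2 / (r ^ 4 * (r - 2 * M)) := by
      have h := hA r hr
      rw [hA0] at h
      field_simp at h ⊢
      linarith
    have hle : (1 - 2 * C) * r ≤ r - 2 * M := by rw [hM]; nlinarith
    have hden : (1 - 2 * C) * r ^ 5 ≤ r ^ 4 * (r - 2 * M) := by
      nlinarith [mul_le_mul_of_nonneg_left hle (pow_pos hr0 4).le]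
    rw [neg_neg, heq, hN, div_div, abs_div, abs_of_pos (by positivity : 0 < r ^ 4 * (r - 2 * M)),
      abs_mul, abs_mul, abs_of_nonneg (sq_nonneg M), abs_of_pos (by norm_num : (0 : ℝ) < 16)]
    gcongr
  obtain ⟨L, hL, hrate⟩ := exists_tendsto_of_abs_deriv_le
    (fun r hr => hdθ r (hR.trans hr)) hg hbound hg0
  refine ⟨L, hL, squeeze_zero_norm' (a := fun r : ℝ => N / 4 * (r ^ 3)⁻¹) ?_ ?_⟩
  · filter_upwards [eventually_gt_atTop R] with r hr
    have hr0 : 0 < r := hR.trans hr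
    rw [Real.norm_eq_abs, abs_mul, abs_of_pos hr0]
    refine (mul_le_mul_of_nonneg_left (hrate r hr) hr0.le).trans_eq ?_
    field_simp
  · simpa using ((tendsto_pow_atTop (α := ℝ) (n := 3) (by norm_num)).inv_tendsto_atTop).const_mul
      (N / 4)
end
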